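/- Let (A, B, T) be a pseudo-commutative tetrablock isometry on H (T isometry, AT = TA, BT = TB, A = B*T) and suppose additionally AB = BA, r(A) ≤ 1 and r(B) ≤ 1. Then ‖A‖ ≤ 1 and ‖B‖ ≤ 1. -/

import Mathlib

open ContinuousLinearMap

/-- The spectral radius is submultiplicative on commuting elements. -/
theorem Commute.spectralRadius_mul_le {E : Type*} [NormedRing E] [NormedAlgebra ℂ E]
    [CompleteSpace E] {a b : E} (h : Commute a b) (ha : spectralRadius ℂ a ≠ ⊤)
    (hb : spectralRadius ℂ b ≠ ⊤) :
    spectralRadius ℂ (a * b) ≤ spectralRadius ℂ a * spectralRadius ℂ b := by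
  refine le_of_tendsto_of_tendsto' (spectrum.pow_nnnorm_pow_one_div_tendsto_nhds_spectralRadius _)
    (ENNReal.Tendsto.mul (spectrum.pow_nnnorm_pow_one_div_tendsto_nhds_spectralRadius a)
      (Or.inr hb) (spectrum.pow_nnnorm_pow_one_div_tendsto_nhds_spectralRadius b)
      (Or.inr ha)) fun n => ?_
  rw [h.mul_pow, ← ENNReal.mul_rpow_of_nonneg _ _ (by positivity)]
  gcongr
  exact_mod_cast nnnorm_mul_le (a ^ n) (b ^ n)

section CStar

variable {E : Type*} [CStarAlgebra E] {a b s u : E}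

theorem norm_le_one_of_star_mul_self_eq_one (hu : star u * u = 1) : ‖u‖ ≤ 1 := by
  have h1 := CStarRing.norm_star_mul_self (x := (1 : E))
  have hu' := CStarRing.norm_star_mul_self (x := u)
  rw [hu] at hu'
  rw [star_one, one_mul] at h1
  by_contra! h
  have : 1 < ‖(1 : E)‖ := by nlinarith
  nlinarith

/-- If `a = b⋆ u` for an isometry `u` commuting with `b`, then also `b = a⋆ u`. -/
theorem eq_star_mul_of_eq_star_mul (hu : star u * u = 1) (hbu : Commute b u)
    (ha : a = star b * u) : b = star a * u := by
  rw [ha, star_mul, star_star, mul_assoc, hbu.eq, ← mul_assoc, hu, one_mul]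

theorem norm_mul_self_le_of_eq_star_mul (hu : star u * u = 1) (hbu : Commute b u)
    (ha : a = star b * u) : ‖b‖ * ‖b‖ ≤ ‖a * b‖ := by
  have hbb : star u * (a * b) = star b * b := calc
    star u * (a * b) = star (b * u) * (u * b) := by rw [ha, star_mul]; simp only [mul_assoc]
    _ = star b * (star u * u) * b := by rw [hbu.eq, star_mul]; simp only [mul_assoc]
    _ = star b * b := by rw [hu, mul_one]
  calc ‖b‖ * ‖b‖ = ‖star u * (a * b)‖ := by rw [hbb, CStarRing.norm_star_mul_self]
    _ ≤ ‖star u‖ * ‖a * b‖ := norm_mul_le _ _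
    _ ≤ 1 * ‖a * b‖ := by
      gcongr
      rw [norm_star]
      exact norm_le_one_of_star_mul_self_eq_one hu
    _ = ‖a * b‖ := one_mul _

/-- If `a = b⋆ u` for an isometry `u` commuting with `b`, then `a b = (a b)⋆ u ^ 2`. -/
theorem mul_eq_star_mul_mul_sq (hu : star u * u = 1) (hbu : Commute b u) (ha : a = star b * u) :
    a * b = star (a * b) * u ^ 2 := by
  have hb := eq_star_mul_of_eq_star_mul hu hbu ha
  calc a * b = star b * (u * b) := by rw [← mul_assoc, ← ha]
    _ = star b * (star a * u * u) := by rw [← hbu.eq, ← hb]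
    _ = star (a * b) * u ^ 2 := by rw [star_mul, sq]; simp only [mul_assoc]

theorem star_sq_mul_sq_eq_one (hu : star u * u = 1) : star (u ^ 2) * u ^ 2 = 1 := by
  rw [sq, star_mul, mul_assoc, ← mul_assoc (star u) u, hu, one_mul, hu]

theorem nnnorm_pow_two_pow_of_eq_star_mul (hu : star u * u = 1) (hsu : Commute s u)
    (hs : s = star s * u) (n : ℕ) : ‖s ^ 2 ^ n‖₊ = ‖s‖₊ ^ 2 ^ n := by
  induction n generalizing s u with
  | zero => simp
  | succ n ih =>
    have hsq : ‖s ^ 2‖₊ = ‖s‖₊ ^ 2 := by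
      rw [sq, sq]
      exact le_antisymm (nnnorm_mul_le _ _) (norm_mul_self_le_of_eq_star_mul hu hsu hs)
    rw [pow_succ' 2 n, pow_mul, pow_mul, ← hsq]
    refine ih (star_sq_mul_sq_eq_one hu) (hsu.pow_pow 2 2) ?_
    rw [sq s]
    exact mul_eq_star_mul_mul_sq hu hsu hs

theorem spectralRadius_eq_nnnorm_of_eq_star_mul (hu : star u * u = 1) (hsu : Commute s u)
    (hs : s = star s * u) : spectralRadius ℂ s = ‖s‖₊ := by
  refine tendsto_nhds_unique ?_ tendsto_const_nhds (l := Filter.atTop (α := ℕ))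
    (f := fun _ => (‖s‖₊ : ENNReal))
  convert! (spectrum.pow_nnnorm_pow_one_div_tendsto_nhds_spectralRadius s).comp
    (tendsto_pow_atTop_atTop_of_one_lt one_lt_two) using 1
  refine funext fun n => ?_
  rw [Function.comp_apply, nnnorm_pow_two_pow_of_eq_star_mul hu hsu hs, ENNReal.coe_pow,
    ← ENNReal.rpow_natCast, ← ENNReal.rpow_mul]
  simp

/-- If `a = b⋆ u` for an isometry `u` and `a`, `b`, `u` commute, then the spectral radius of `a b`
is `max (‖a‖ ^ 2) (‖b‖ ^ 2)`. -/
theorem spectralRadius_mul_eq_max_of_eq_star_mul (hu : star u * u = 1) (hau : Commute a u)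
    (hbu : Commute b u) (hab : Commute a b) (ha : a = star b * u) :
    spectralRadius ℂ (a * b) = (max (‖a‖₊ ^ 2) (‖b‖₊ ^ 2) : NNReal) := by
  rw [spectralRadius_eq_nnnorm_of_eq_star_mul (star_sq_mul_sq_eq_one hu)
    ((hau.mul_left hbu).pow_right 2) (mul_eq_star_mul_mul_sq hu hbu ha), ENNReal.coe_inj]
  have hb_le : ‖b‖ ^ 2 ≤ ‖a * b‖ := by
    rw [sq]
    exact norm_mul_self_le_of_eq_star_mul hu hbu ha
  have ha_le : ‖a‖ ^ 2 ≤ ‖a * b‖ := by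
    rw [sq, hab.eq]
    exact norm_mul_self_le_of_eq_star_mul hu hau (eq_star_mul_of_eq_star_mul hu hbu ha)
  refine le_antisymm ((nnnorm_mul_le a b).trans ?_) (max_le ha_le hb_le)
  rcases le_total ‖a‖₊ ‖b‖₊ with h | h
  · exact le_max_of_le_right (by rw [sq]; gcongr)
  · exact le_max_of_le_left (by rw [sq]; gcongr)

end CStar

/-- If `(A, B, T)` is a pseudo-commutative tetrablock isometry with `AB = BA`,
`r(A) ≤ 1` and `r(B) ≤ 1`, then `A` and `B` are contractions. -/
theorem stmt12 {H : Type*} [NormedAddCommGroup H] [InnerProductSpace ℂ H] [CompleteSpace H]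
    (A B T : H →L[ℂ] H) (hT : adjoint T ∘L T = 1)
    (hAT : A ∘L T = T ∘L A) (hBT : B ∘L T = T ∘L B)
    (hA : A = adjoint B ∘L T) (hAB : A ∘L B = B ∘L A)
    (hrA : spectralRadius ℂ A ≤ 1) (hrB : spectralRadius ℂ B ≤ 1) :
    ‖A‖ ≤ 1 ∧ ‖B‖ ≤ 1 := by
  have hr : spectralRadius ℂ (A * B) ≤ 1 :=
    (Commute.spectralRadius_mul_le hAB (ne_top_of_le_ne_top ENNReal.one_ne_top hrA)
      (ne_top_of_le_ne_top ENNReal.one_ne_top hrB)).trans (mul_le_one' hrA hrB)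
  rw [spectralRadius_mul_eq_max_of_eq_star_mul hT hAT hBT hAB hA, ENNReal.coe_le_one_iff,
    max_le_iff] at hr
  exact ⟨(pow_le_one_iff_of_nonneg (norm_nonneg A) two_ne_zero).1 hr.1,
    (pow_le_one_iff_of_nonneg (norm_nonneg B) two_ne_zero).1 hr.2⟩
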